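/- arXiv:2201.13283 — 10 statements merged into one kernel-verified Lean document; each statement's English description precedes it below -/
import Mathlib

section
/- Let G be a countable group, M ⊆ G a finite subset, A a finite set, S = A^(A^M), and s ∈ S^G. Then the following are equivalent: (i) σ_s is reversible; (ii) σ_s is stably reversible; (iii) σ_s is stably injective. -/
open Pointwise

section ANUCA

variable {G : Type*} [Group G] {A : Type*}

/-- The shift action of `G` on configurations: `(g · x) h = x (g⁻¹ * h)`. -/
def shiftC {S : Type*} (g : G) (x : G → S) : G → S := fun h => x (g⁻¹ * h)

/-- The prodiscrete topology on `G → S` (product topology, `S` discrete). -/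
def prodiscrete (G S : Type*) : TopologicalSpace (G → S) :=
  @Pi.topologicalSpace G (fun _ => S) (fun _ => ⊥)

/-- `Σ(s)`: the closure of the shift orbit of `s` in the prodiscrete topology. -/
def orbitClosure {S : Type*} (s : G → S) : Set (G → S) :=
  @closure _ (prodiscrete G S) {p | ∃ g : G, shiftC g s = p}

/-- The ANUCA `σ_s` with memory `M` associated with the configuration of local
defining maps `s : G → (A^M → A)`, namely `σ_s x g = s g ((g⁻¹ · x)|_M)`. -/
def anuca (M : Set G) (s : G → ((M → A) → A)) (x : G → A) : G → A :=
  fun g => s g (fun m => x (g * (m : G)))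

/-- `σ_s` is stably injective if `σ_p` is injective for every `p ∈ Σ(s)`. -/
def StablyInjective (M : Set G) (s : G → ((M → A) → A)) : Prop :=
  ∀ p ∈ orbitClosure s, Function.Injective (anuca M p)

/-- `σ_s` is reversible if `σ_w ∘ σ_s = Id` for some ANUCA `σ_w` with finite memory. -/
def Reversible (M : Set G) (s : G → ((M → A) → A)) : Prop :=
  ∃ N : Set G, N.Finite ∧ ∃ w : G → ((N → A) → A), anuca N w ∘ anuca M s = id

/-- `σ_s` is stably reversible if there are a finite `N ⊆ G` and `q ∈ T^G`,
`T = A^(A^N)`, such that every `p ∈ Σ(s)` admits `w ∈ Σ(q)` with `σ_w ∘ σ_p = Id`. -/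
def StablyReversible (M : Set G) (s : G → ((M → A) → A)) : Prop :=
  ∃ N : Set G, N.Finite ∧ ∃ q : G → ((N → A) → A),
    ∀ p ∈ orbitClosure s, ∃ w ∈ orbitClosure q, anuca N w ∘ anuca M p = id

/-- `σ_s` is invertible if it is bijective and its inverse is an ANUCA with finite memory. -/
def InvertibleANUCA (M : Set G) (s : G → ((M → A) → A)) : Prop :=
  Function.Bijective (anuca M s) ∧
    ∃ N : Set G, N.Finite ∧ ∃ w : G → ((N → A) → A),
      anuca N w ∘ anuca M s = id ∧ anuca M s ∘ anuca N w = id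

/-- Two configurations are asymptotic if they agree outside a finite set. -/
def Asymptotic {S : Type*} (x y : G → S) : Prop := {g : G | x g ≠ y g}.Finite

/-- A map `τ : A^G → A^G` is pre-injective if it is injective on asymptotic pairs. -/
def PreInjective (τ : (G → A) → (G → A)) : Prop :=
  ∀ x y : G → A, Asymptotic x y → τ x = τ y → x = y

/-- A map `τ : A^G → A^G` is post-surjective if every configuration asymptotic to
`τ x` is the image of a configuration asymptotic to `x`. -/
def PostSurjective (τ : (G → A) → (G → A)) : Prop :=
  ∀ x y : G → A, Asymptotic y (τ x) → ∃ z : G → A, Asymptotic z x ∧ τ z = y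

end ANUCA


section ANUCA

variable {G : Type*} [Group G] {A : Type*}

theorem orbitClosure_eq_closure_range {S : Type*} [t : TopologicalSpace S] [DiscreteTopology S]
    (s : G → S) : orbitClosure s = closure (Set.range fun g : G => shiftC g s) := by
  obtain rfl : t = ⊥ := DiscreteTopology.eq_bot
  rfl

theorem shiftC_mem_orbitClosure {S : Type*} (s : G → S) (g : G) :
    shiftC g s ∈ orbitClosure s :=
  @subset_closure _ (prodiscrete G S) _ _ ⟨g, rfl⟩

theorem shiftC_one {S : Type*} (s : G → S) : shiftC 1 s = s := by
  funext h
  simp [shiftC]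

theorem shiftC_shiftC_inv {S : Type*} (g : G) (s : G → S) : shiftC g (shiftC g⁻¹ s) = s := by
  funext h
  simp [shiftC]

theorem anuca_shiftC (M : Set G) (s : G → ((M → A) → A)) (g : G) (x : G → A) :
    anuca M (shiftC g s) (shiftC g x) = shiftC g (anuca M s x) := by
  funext h
  simp [shiftC, anuca, mul_assoc]

theorem anuca_comp_anuca_shiftC {M N : Set G} {s : G → ((M → A) → A)} {w : G → ((N → A) → A)}
    (h : anuca N w ∘ anuca M s = id) (g : G) :
    anuca N (shiftC g w) ∘ anuca M (shiftC g s) = id := by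
  funext x
  rw [← shiftC_shiftC_inv g x]
  simp only [Function.comp_apply, anuca_shiftC, id]
  exact congrArg (shiftC g) (congrFun h _)

section Topology

variable [TopologicalSpace A] [DiscreteTopology A] [Finite A]

theorem continuous_anuca {M : Set G} [Finite M] :
    Continuous fun z : (G → ((M → A) → A)) × (G → A) => anuca M z.1 z.2 := by
  refine continuous_pi fun g => ?_
  have hev : Continuous fun u : ((M → A) → A) × (M → A) => u.1 u.2 :=
    continuous_of_discreteTopology
  have hpair : Continuous fun z : (G → ((M → A) → A)) × (G → A) =>
      (z.1 g, fun m : M => z.2 (g * (m : G))) := by fun_prop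
  exact hev.comp hpair

theorem isClosed_setOf_anuca_comp_eq_id (M N : Set G) [Finite M] [Finite N] :
    IsClosed {z : (G → ((M → A) → A)) × (G → ((N → A) → A)) |
      anuca N z.2 ∘ anuca M z.1 = id} := by
  have : {z : (G → ((M → A) → A)) × (G → ((N → A) → A)) | anuca N z.2 ∘ anuca M z.1 = id} =
      ⋂ x : G → A, {z | anuca N z.2 (anuca M z.1 x) = x} := by
    ext z
    simp [funext_iff]
  rw [this]
  refine isClosed_iInter fun x => isClosed_eq ?_ continuous_const
  exact continuous_anuca.comp (continuous_snd.prodMk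
    (continuous_anuca.comp (continuous_fst.prodMk continuous_const)))

end Topology

theorem Reversible.stablyReversible [Finite A] {M : Set G} (hM : M.Finite)
    {s : G → ((M → A) → A)} (h : Reversible M s) : StablyReversible M s := by
  obtain ⟨N, hN, w, hw⟩ := h
  let : TopologicalSpace A := ⊥
  have : DiscreteTopology A := ⟨rfl⟩
  have : Finite M := hM
  have : Finite N := hN
  refine ⟨N, hN, w, ?_⟩
  let K : Set ((G → ((M → A) → A)) × (G → ((N → A) → A))) :=
    {z | anuca N z.2 ∘ anuca M z.1 = id} ∩ {z | z.2 ∈ orbitClosure w}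
  have hK : IsClosed K := by
    refine (isClosed_setOf_anuca_comp_eq_id M N).inter ?_
    rw [orbitClosure_eq_closure_range]
    exact isClosed_closure.preimage continuous_snd
  have hsub : orbitClosure s ⊆ Prod.fst '' K := by
    rw [orbitClosure_eq_closure_range]
    refine closure_minimal ?_ (hK.isCompact.image continuous_fst).isClosed
    rintro _ ⟨g, rfl⟩
    exact ⟨(shiftC g s, shiftC g w),
      ⟨anuca_comp_anuca_shiftC hw g, shiftC_mem_orbitClosure w g⟩, rfl⟩
  intro p hp
  obtain ⟨z, ⟨hz, hzw⟩, rfl⟩ := hsub hp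
  exact ⟨z.2, hzw, hz⟩

theorem StablyReversible.reversible {M : Set G} {s : G → ((M → A) → A)}
    (h : StablyReversible M s) : Reversible M s := by
  obtain ⟨N, hN, q, hq⟩ := h
  obtain ⟨w, -, hw⟩ := hq s (by simpa only [shiftC_one] using shiftC_mem_orbitClosure s 1)
  exact ⟨N, hN, w, hw⟩

theorem StablyReversible.stablyInjective {M : Set G} {s : G → ((M → A) → A)}
    (h : StablyReversible M s) : StablyInjective M s := by
  obtain ⟨N, -, q, hq⟩ := h
  intro p hp
  obtain ⟨w, -, hw⟩ := hq p hp
  exact Function.LeftInverse.injective (congrFun hw)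

/-- If `σ_s` is stably injective, a finite window of the image around `g`, of shape independent
of `g`, determines the value of the preimage at `g`. -/
theorem StablyInjective.exists_finset [Finite A] {M : Set G} (hM : M.Finite)
    {s : G → ((M → A) → A)} (h : StablyInjective M s) :
    ∃ N : Finset G, ∀ (g : G) (x y : G → A),
      (∀ n ∈ N, anuca M s x (g * n) = anuca M s y (g * n)) → x g = y g := by
  classical
  let : TopologicalSpace A := ⊥
  have : DiscreteTopology A := ⟨rfl⟩
  have : Finite M := hM
  let D : Set ((G → ((M → A) → A)) × (G → A) × (G → A)) :=
    {z | z.1 ∈ orbitClosure s} ∩ {z | z.2.1 1 ≠ z.2.2 1}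
  have hD : IsClosed D := by
    refine IsClosed.inter ?_ ?_
    · rw [orbitClosure_eq_closure_range]
      exact isClosed_closure.preimage continuous_fst
    · have hc : Continuous fun z : (G → ((M → A) → A)) × (G → A) × (G → A) =>
          (z.2.1 1, z.2.2 1) := by fun_prop
      exact (isClosed_discrete {u : A × A | u.1 ≠ u.2}).preimage hc
  have hE (n : G) : IsClosed {z : (G → ((M → A) → A)) × (G → A) × (G → A) |
      anuca M z.1 z.2.1 n = anuca M z.1 z.2.2 n} := by
    refine isClosed_eq ?_ ?_
    · exact (continuous_apply n).comp (continuous_anuca.comp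
        (continuous_fst.prodMk (continuous_fst.comp continuous_snd)))
    · exact (continuous_apply n).comp (continuous_anuca.comp
        (continuous_fst.prodMk (continuous_snd.comp continuous_snd)))
  obtain ⟨N, hN⟩ := hD.isCompact.elim_finite_subfamily_closed _ hE (by
    rw [Set.eq_empty_iff_forall_notMem]
    rintro ⟨p, x, y⟩ ⟨⟨hp, hxy⟩, hz⟩
    rw [Set.mem_iInter] at hz
    exact hxy (congrFun (h p hp (funext hz)) 1))
  refine ⟨N, fun g x y hxy => ?_⟩
  by_contra hne
  refine (Set.eq_empty_iff_forall_notMem.mp hN)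
    (shiftC g⁻¹ s, shiftC g⁻¹ x, shiftC g⁻¹ y) ⟨⟨shiftC_mem_orbitClosure s g⁻¹, ?_⟩, ?_⟩
  · simpa [shiftC] using hne
  · simp only [Set.mem_iInter, Set.mem_ofPred_eq, anuca_shiftC]
    intro n hn
    simpa [shiftC] using hxy n hn

theorem StablyInjective.reversible [Finite A] {M : Set G} (hM : M.Finite)
    {s : G → ((M → A) → A)} (h : StablyInjective M s) : Reversible M s := by
  classical
  obtain ⟨N, hN⟩ := h.exists_finset hM
  let N' : Set G := insert 1 (N : Set G)
  refine ⟨N', N.finite_toSet.insert 1, fun g f =>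
    if hf : ∃ x : G → A, ∀ n : N', anuca M s x (g * n) = f n then hf.choose g
    else f ⟨1, Set.mem_insert _ _⟩, ?_⟩
  funext x g
  have hf : ∃ y : G → A, ∀ n : N', anuca M s y (g * n) = anuca M s x (g * n) :=
    ⟨x, fun _ => rfl⟩
  change dite _ _ _ = x g
  rw [dif_pos hf]
  exact hN g _ x fun n hn => hf.choose_spec ⟨n, Set.mem_insert_of_mem _ hn⟩

end ANUCA

/-- Theorem A: for an ANUCA with finite memory over a countable group and finite
alphabet, reversibility, stable reversibility and stable injectivity are equivalent. -/
theorem stmt0 {G A : Type*} [Group G] [Countable G] [Finite A]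
    (M : Set G) (hM : M.Finite) (s : G → ((M → A) → A)) :
    (Reversible M s ↔ StablyReversible M s) ∧
      (StablyReversible M s ↔ StablyInjective M s) := by
  exact ⟨⟨Reversible.stablyReversible hM, StablyReversible.reversible⟩,
    StablyReversible.stablyInjective,
    fun h => (h.reversible hM).stablyReversible hM⟩
end

section
/- Let G be a countable residually finite group (i.e., for every finite subset E ⊆ G there exist a finite group H and a surjective group homomorphism φ : G → H whose restriction to E is injective). Let M ⊆ G be a finite subset, A a finite set, S = A^(A^M), and let s ∈ S^G be asymptotic to a constant configuration c ∈ S^G. If σ_s and σ_c are both injective, then σ_s and σ_c are invertible. -/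
open Pointwise

section Anuca

variable {G A : Type*} [Group G]

theorem continuous_anuca_apply [TopologicalSpace A] [DiscreteTopology A] {M : Set G}
    (hM : M.Finite) (s : G → ((M → A) → A)) (g : G) :
    Continuous fun x : G → A => anuca M s x g := by
  have : Finite M := hM
  exact (continuous_of_discreteTopology (f := s g)).comp
    (continuous_pi fun m => continuous_apply (g * (m : G)))

/-- If `σ_s` is injective, each value `x g` depends only on finitely many values of `σ_s x`. -/
theorem exists_finite_determining_set [Finite A] {M : Set G} (hM : M.Finite)
    {s : G → ((M → A) → A)} (hs : Function.Injective (anuca M s)) (g : G) :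
    ∃ N : Set G, N.Finite ∧
      ∀ x y : G → A, (∀ n ∈ N, anuca M s x n = anuca M s y n) → x g = y g := by
  let _ : TopologicalSpace A := ⊥
  have : DiscreteTopology A := ⟨rfl⟩
  have hK : IsCompact {p : (G → A) × (G → A) | p.1 g ≠ p.2 g} := by
    refine IsClosed.isCompact ?_
    exact (isClosed_discrete {q : A × A | q.1 ≠ q.2}).preimage
      (f := fun p : (G → A) × (G → A) => (p.1 g, p.2 g)) (by fun_prop)
  obtain ⟨N, hN⟩ := hK.elim_finite_subfamily_closed
    (fun n : G => {p : (G → A) × (G → A) | anuca M s p.1 n = anuca M s p.2 n})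
    (fun n => isClosed_eq ((continuous_anuca_apply hM s n).comp continuous_fst)
      ((continuous_anuca_apply hM s n).comp continuous_snd))
    (by
      rw [Set.eq_empty_iff_forall_notMem]
      rintro ⟨x, y⟩ ⟨hxy, h⟩
      have h_eq : anuca M s x = anuca M s y := funext fun n => Set.mem_iInter.1 h n
      exact hxy (congrFun (hs h_eq) g))
  refine ⟨N, N.finite_toSet, fun x y h => ?_⟩
  by_contra hxy
  have hmem : (x, y) ∈ (∅ : Set ((G → A) × (G → A))) := by
    rw [← hN]
    exact ⟨hxy, Set.mem_iInter₂.2 fun n hn => h n hn⟩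
  exact hmem

/-- An ANUCA whose image contains every finite pattern is surjective. -/
theorem anuca_surjective_of_finite_patterns [Finite A] {M : Set G} (hM : M.Finite)
    {s : G → ((M → A) → A)}
    (h : ∀ (z : G → A) (E : Set G), E.Finite → ∃ x, ∀ e ∈ E, anuca M s x e = z e) :
    Function.Surjective (anuca M s) := by
  intro z
  let _ : TopologicalSpace A := ⊥
  have : DiscreteTopology A := ⟨rfl⟩
  obtain ⟨x, -, hx⟩ := isCompact_univ.inter_iInter_nonempty
    (fun e : G => {x : G → A | anuca M s x e = z e})
    (fun e => isClosed_eq (continuous_anuca_apply hM s e) continuous_const)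
    (fun E => by
      obtain ⟨x, hx⟩ := h z E E.finite_toSet
      exact ⟨x, trivial, Set.mem_iInter₂.2 fun e he => hx e he⟩)
  exact ⟨x, funext fun e => Set.mem_iInter.1 hx e⟩

theorem anuca_comp_mul_left {M : Set G} {c : G → ((M → A) → A)}
    (hconst : ∀ g h : G, c g = c h) (x : G → A) (g n : G) :
    anuca M c (fun k => x (g * k)) n = anuca M c x (g * n) := by
  simp only [anuca, mul_assoc, hconst n (g * n)]

theorem exists_finite_determining_set_of_const [Finite A] {M : Set G} (hM : M.Finite)
    {c : G → ((M → A) → A)} (hconst : ∀ g h : G, c g = c h)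
    (hc : Function.Injective (anuca M c)) :
    ∃ N : Set G, N.Finite ∧ ∀ (x y : G → A) (g : G),
      (∀ n ∈ N, anuca M c x (g * n) = anuca M c y (g * n)) → x g = y g := by
  obtain ⟨N, hN, h⟩ := exists_finite_determining_set hM hc 1
  refine ⟨N, hN, fun x y g hxy => ?_⟩
  simpa using h (fun k => x (g * k)) (fun k => y (g * k)) fun n hn => by
    simpa only [anuca_comp_mul_left hconst] using hxy n hn

/-- The determining sets of an injective ANUCA asymptotic to an injective cellular automaton can
be chosen uniformly. -/
theorem exists_uniform_determining_set [Finite A] {M : Set G} (hM : M.Finite)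
    {s c : G → ((M → A) → A)} (hconst : ∀ g h : G, c g = c h) (hasym : Asymptotic s c)
    (hs : Function.Injective (anuca M s)) (hc : Function.Injective (anuca M c)) :
    ∃ N : Set G, N.Finite ∧
      (∀ (x y : G → A) (g : G),
        (∀ n ∈ N, anuca M c x (g * n) = anuca M c y (g * n)) → x g = y g) ∧
      ∀ (x y : G → A) (g : G),
        (∀ n ∈ N, anuca M s x (g * n) = anuca M s y (g * n)) → x g = y g := by
  obtain ⟨N, hN, h⟩ := exists_finite_determining_set_of_const hM hconst hc
  choose P hP hPdet using exists_finite_determining_set hM hs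
  have hF : ({g | s g ≠ c g} * N⁻¹).Finite := Set.Finite.mul hasym hN.inv
  refine ⟨N ∪ ⋃ f ∈ {g | s g ≠ c g} * N⁻¹, (fun p => f⁻¹ * p) '' P f,
    hN.union (hF.biUnion fun f _ => (hP f).image _),
    fun x y g hxy => h x y g fun n hn => hxy n (Or.inl hn), fun x y g hxy => ?_⟩
  by_cases hg : g ∈ {g | s g ≠ c g} * N⁻¹
  · refine hPdet g x y fun p hp => ?_
    simpa using hxy (g⁻¹ * p) (Or.inr (Set.mem_biUnion hg ⟨p, hp, rfl⟩))
  · refine h x y g fun n hn => ?_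
    have hsc : s (g * n) = c (g * n) := by
      by_contra hne
      exact hg ⟨g * n, hne, n⁻¹, Set.inv_mem_inv.2 hn, by simp⟩
    simpa only [anuca, hsc] using hxy n (Or.inl hn)

theorem anuca_surjective [Finite A]
    (hres : ∀ E : Set G, E.Finite →
      ∃ (H : Type) (_ : Group H) (_ : Finite H) (φ : G →* H),
        Function.Surjective φ ∧ Set.InjOn φ E)
    {M : Set G} (hM : M.Finite) {s c : G → ((M → A) → A)}
    (hconst : ∀ g h : G, c g = c h) (hasym : Asymptotic s c)
    (hs : Function.Injective (anuca M s)) (hc : Function.Injective (anuca M c)) :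
    Function.Surjective (anuca M s) := by
  classical
  obtain ⟨N, hN, hNc, hNs⟩ := exists_uniform_determining_set hM hconst hasym hs hc
  refine anuca_surjective_of_finite_patterns hM fun z E hE => ?_
  set D : Set G := {g | s g ≠ c g} with hD
  have hDfin : D.Finite := hasym
  set F : Set G := D * N⁻¹
  have hFfin : F.Finite := hDfin.mul hN.inv
  obtain ⟨H, _, _, φ, hφ, hinj⟩ := hres (E ∪ D ∪ F * N) ((hE.union hDfin).union (hFfin.mul hN))
  -- the local rules induced on the finite quotient
  let t : H → ((M → A) → A) := fun h => if hh : ∃ d ∈ D, φ d = h then s hh.choose else c 1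
  let τ : (H → A) → (H → A) := fun u h => t h fun m => u (h * φ m)
  have ht_mem : ∀ g ∈ E ∪ D ∪ F * N, t (φ g) = s g := by
    intro g hg
    by_cases hh : ∃ d ∈ D, φ d = φ g
    · have h_eq : hh.choose = g :=
        hinj (Or.inl (Or.inr hh.choose_spec.1)) hg hh.choose_spec.2
      simp only [t, dif_pos hh, h_eq]
    · have hgD : g ∉ D := fun hgD => hh ⟨g, hgD, rfl⟩
      have hsc : s g = c g := by simpa [hD] using hgD
      simp only [t, dif_neg hh, hsc, hconst 1 g]
  have hτs : ∀ (u : H → A), ∀ g ∈ E ∪ D ∪ F * N, anuca M s (u ∘ φ) g = τ u (φ g) := by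
    intro u g hg
    simp only [anuca, τ, ht_mem g hg, Function.comp_apply, map_mul]
  have hτinj : Function.Injective τ := by
    intro u v huv
    funext h
    by_cases hh : ∃ f ∈ F, φ f = h
    · obtain ⟨f, hf, rfl⟩ := hh
      refine hNs (u ∘ φ) (v ∘ φ) f fun n hn => ?_
      have hmem : f * n ∈ E ∪ D ∪ F * N := Or.inr (Set.mul_mem_mul hf hn)
      rw [hτs u _ hmem, hτs v _ hmem, huv]
    · obtain ⟨g, rfl⟩ := hφ h
      refine hNc (u ∘ φ) (v ∘ φ) g fun n hn => ?_
      have hnot : ¬ ∃ d ∈ D, φ d = φ (g * n) := by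
        rintro ⟨d, hd, hdn⟩
        exact hh ⟨d * n⁻¹, Set.mul_mem_mul hd (Set.inv_mem_inv.2 hn), by simp [hdn]⟩
      have hτc : ∀ w : H → A, anuca M c (w ∘ φ) (g * n) = τ w (φ (g * n)) := by
        intro w
        have ht : t (φ (g * n)) = c (g * n) := (dif_neg hnot).trans (hconst 1 (g * n))
        simp only [anuca, τ, ht]
        simp only [Function.comp_apply, map_mul]
      rw [hτc u, hτc v, huv]
  have hτsurj : Function.Surjective τ := Finite.surjective_of_injective hτinj
  obtain ⟨u, hu⟩ := hτsurj (z ∘ Function.invFunOn φ E)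
  refine ⟨u ∘ φ, fun e he => ?_⟩
  have hinv : Function.invFunOn φ E (φ e) = e :=
    (hinj.mono fun _ h => Or.inl (Or.inl h)).leftInvOn_invFunOn he
  rw [hτs u e (Or.inl (Or.inl he)), hu, Function.comp_apply, hinv]

theorem invertibleANUCA_of_asymptotic_const [Finite A]
    (hres : ∀ E : Set G, E.Finite →
      ∃ (H : Type) (_ : Group H) (_ : Finite H) (φ : G →* H),
        Function.Surjective φ ∧ Set.InjOn φ E)
    {M : Set G} (hM : M.Finite) {s c : G → ((M → A) → A)}
    (hconst : ∀ g h : G, c g = c h) (hasym : Asymptotic s c)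
    (hs : Function.Injective (anuca M s)) (hc : Function.Injective (anuca M c)) :
    InvertibleANUCA M s := by
  classical
  have hsurj := anuca_surjective hres hM hconst hasym hs hc
  obtain ⟨N, hN, -, hdet⟩ := exists_uniform_determining_set hM hconst hasym hs hc
  rcases isEmpty_or_nonempty A with hA | ⟨⟨a⟩⟩
  · have : IsEmpty (G → A) := ⟨fun x => hA.elim (x 1)⟩
    exact ⟨⟨hs, hsurj⟩, {1}, Set.finite_singleton 1, fun _ p => p ⟨1, rfl⟩,
      Subsingleton.elim _ _, Subsingleton.elim _ _⟩
  let w : G → ((N → A) → A) := fun g p =>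
    if h : ∃ y : G → A, ∀ n : N, anuca M s y (g * n) = p n then h.choose g else a
  have hw : ∀ x, anuca N w (anuca M s x) = x := by
    intro x
    funext g
    have h : ∃ y : G → A, ∀ n : N, anuca M s y (g * n) = anuca M s x (g * n) :=
      ⟨x, fun _ => rfl⟩
    change (if h : ∃ y : G → A, ∀ n : N, anuca M s y (g * n) = anuca M s x (g * n)
      then h.choose g else a) = x g
    rw [dif_pos h]
    exact hdet _ _ g fun n hn => h.choose_spec ⟨n, hn⟩
  refine ⟨⟨hs, hsurj⟩, N, hN, w, funext hw, funext fun y => ?_⟩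
  obtain ⟨x, rfl⟩ := hsurj y
  simp only [Function.comp_apply, hw, id_eq]

end Anuca

/-- Over a countable residually finite group, if `s` is asymptotic to a constant
configuration `c` and both `σ_s` and `σ_c` are injective, then both are invertible. -/
theorem stmt1 {G A : Type*} [Group G] [Countable G] [Finite A]
    (hres : ∀ E : Set G, E.Finite →
      ∃ (H : Type) (_ : Group H) (_ : Finite H) (φ : G →* H),
        Function.Surjective φ ∧ Set.InjOn φ E)
    (M : Set G) (hM : M.Finite) (s c : G → ((M → A) → A))
    (hconst : ∀ g h : G, c g = c h) (hasym : Asymptotic s c)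
    (hs : Function.Injective (anuca M s)) (hc : Function.Injective (anuca M c)) :
    InvertibleANUCA M s ∧ InvertibleANUCA M c :=
  ⟨invertibleANUCA_of_asymptotic_const hres hM hconst hasym hs hc,
    invertibleANUCA_of_asymptotic_const hres hM hconst (by simp [Asymptotic]) hc hc⟩
end

section
/- Let d ≥ 1, let M ⊆ ℤ^d be a finite subset, A a finite set, S = A^(A^M), and s ∈ S^(ℤ^d). If the ANUCA σ_s is stably injective and has bounded singularity, then σ_s is invertible. -/
open Pointwise

/-- The universe `ℤ^d`. -/
abbrev Zd (d : ℕ) := Fin d → ℤ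

variable {d : ℕ} {A : Type*}

/-- The shift action of `ℤ^d` on configurations: `(g · x) h = x (h - g)`. -/
def shiftZ {S : Type*} (g : Zd d) (x : Zd d → S) : Zd d → S := fun h => x (h - g)

/-- The prodiscrete topology on `ℤ^d → S`. -/
def prodiscreteZ (d : ℕ) (S : Type*) : TopologicalSpace (Zd d → S) :=
  @Pi.topologicalSpace (Zd d) (fun _ => S) (fun _ => ⊥)

/-- `Σ(s)`: the closure of the shift orbit of `s` in the prodiscrete topology. -/
def orbitClosureZ {S : Type*} (s : Zd d → S) : Set (Zd d → S) :=
  @closure _ (prodiscreteZ d S) {p | ∃ g : Zd d, shiftZ g s = p}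

/-- The ANUCA `σ_s` with memory `M` over the universe `ℤ^d`. -/
def anucaZ (M : Set (Zd d)) (s : Zd d → ((M → A) → A)) (x : Zd d → A) : Zd d → A :=
  fun g => s g (fun m => x (g + (m : Zd d)))

/-- `σ_s` is stably injective if `σ_p` is injective for every `p ∈ Σ(s)`. -/
def StablyInjectiveZ (M : Set (Zd d)) (s : Zd d → ((M → A) → A)) : Prop :=
  ∀ p ∈ orbitClosureZ s, Function.Injective (anucaZ M p)

/-- `σ_s` is invertible if it is bijective and its inverse is an ANUCA with finite memory. -/
def InvertibleANUCAZ (M : Set (Zd d)) (s : Zd d → ((M → A) → A)) : Prop :=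
  Function.Bijective (anucaZ M s) ∧
    ∃ N : Set (Zd d), N.Finite ∧ ∃ w : Zd d → ((N → A) → A),
      anucaZ N w ∘ anucaZ M s = id ∧ anucaZ M s ∘ anucaZ N w = id

/-- The box `∏_j {a_j, …, b_j} ⊆ ℤ^d`. -/
def box (a b : Zd d) : Set (Zd d) := {g | ∀ j, a j ≤ g j ∧ g j ≤ b j}

/-- `g ≡ h (mod K)` for the box with sides `{a_j, …, b_j}`:
`g_j ≡ h_j (mod b_j - a_j + 1)` for every `j`. -/
def congMod (a b g h : Zd d) : Prop := ∀ j, (b j - a j + 1) ∣ (g j - h j)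

/-- `σ_s` has bounded singularity if every finite `E ⊆ ℤ^d` is contained in a box `K`
such that `s g = s k_g` for all `g ∈ ∂_E^+ K = (K + E) \ K`, where `k_g ∈ K` is the
unique element congruent to `g` mod `K`. -/
def BoundedSingularity (M : Set (Zd d)) (s : Zd d → ((M → A) → A)) : Prop :=
  ∀ E : Set (Zd d), E.Finite → ∃ a b : Zd d, (∀ j, a j ≤ b j) ∧ E ⊆ box a b ∧
    ∀ g ∈ (box a b + E) \ box a b, ∀ k ∈ box a b, congMod a b g k → s g = s k

/-- A stably injective ANUCA over a finite alphabet is uniformly injective: for some finite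
window `N`, the values of the image on `g + N` determine the value of the configuration at `g`. -/
theorem StablyInjectiveZ.exists_window [Finite A] {M : Set (Zd d)} (hM : M.Finite)
    {s : Zd d → ((M → A) → A)} (hinj : StablyInjectiveZ M s) :
    ∃ N : Finset (Zd d), ∀ (g : Zd d) (x y : Zd d → A),
      (∀ n ∈ N, anucaZ M s x (g + n) = anucaZ M s y (g + n)) → x g = y g := by
  classical
  by_contra! hcon
  choose g x y hxy hne using hcon
  have : Finite M := hM
  let U : Ultrafilter (Finset (Zd d)) := Ultrafilter.of Filter.atTop
  have hU : (U : Filter (Finset (Zd d))) ≤ Filter.atTop := Ultrafilter.of_le _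
  have hlim : ∀ {T : Type _} [Finite T] (f : Finset (Zd d) → T), ∃ t, ∀ᶠ n in U, f n = t := by
    intro T _ f
    obtain ⟨t, ht⟩ := Ultrafilter.eq_pure_of_finite (U.map f)
    refine ⟨t, ?_⟩
    have h : ({t} : Set T) ∈ U.map f := by rw [ht]; exact Ultrafilter.mem_pure.2 rfl
    exact h
  choose p hp using fun h => hlim (fun n => shiftZ (-g n) s h)
  choose x' hx' using fun h => hlim (fun n => shiftZ (-g n) (x n) h)
  choose y' hy' using fun h => hlim (fun n => shiftZ (-g n) (y n) h)
  have hmem : p ∈ orbitClosureZ s := by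
    let _ : TopologicalSpace ((M → A) → A) := ⊥
    let _ : TopologicalSpace (Zd d → ((M → A) → A)) := prodiscreteZ d _
    refine mem_closure_of_tendsto (f := fun n => shiftZ (-g n) s) (b := (U : Filter _)) ?_
      (Filter.Eventually.of_forall fun n => ⟨-g n, rfl⟩)
    refine tendsto_pi_nhds.2 fun h => ?_
    exact tendsto_const_nhds.congr' ((hp h).mono fun n hn => hn.symm)
  have heq : anucaZ M p x' = anucaZ M p y' := by
    funext h
    have hx := Filter.eventually_all.2 fun m : M => hx' (h + m)
    have hy := Filter.eventually_all.2 fun m : M => hy' (h + m)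
    have hh : ∀ᶠ n in (U : Filter (Finset (Zd d))), h ∈ n :=
      hU ((Filter.eventually_ge_atTop {h}).mono fun n hn => hn (Finset.mem_singleton_self h))
    obtain ⟨n, hpn, hxn, hyn, hn⟩ := ((hp h).and (hx.and (hy.and hh))).exists
    have key := hxy n h hn
    simp only [shiftZ, sub_neg_eq_add] at hpn hxn hyn
    simp only [anucaZ] at key ⊢
    simp only [← hpn, ← hxn, ← hyn]
    have hadd : ∀ m : M, h + m + g n = g n + h + m := fun m => by abel
    simpa only [hadd, add_comm h (g n)] using key
  obtain ⟨n, hxn, hyn⟩ := ((hx' 0).and (hy' 0)).exists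
  have h0 := congrFun (hinj p hmem heq) 0
  rw [← hxn, ← hyn] at h0
  simp only [shiftZ, sub_neg_eq_add, zero_add] at h0
  exact hne n h0

/-- The representative of `g` modulo the box `∏_j {a_j, …, b_j}`. -/
def boxRep (a b g : Zd d) : Zd d := fun j => a j + (g j - a j) % (b j - a j + 1)

theorem boxRep_mem {a b : Zd d} (hab : ∀ j, a j ≤ b j) (g : Zd d) : boxRep a b g ∈ box a b := by
  intro j
  have := hab j
  have h1 := Int.emod_nonneg (g j - a j) (show b j - a j + 1 ≠ 0 by omega)
  have h2 := Int.emod_lt_of_pos (g j - a j) (show 0 < b j - a j + 1 by omega)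
  simp only [boxRep]
  omega

theorem congMod_boxRep (a b g : Zd d) : congMod a b g (boxRep a b g) := by
  intro j
  have := Int.dvd_self_sub_emod (x := g j - a j) (m := b j - a j + 1)
  simpa only [boxRep, sub_sub] using this

theorem boxRep_of_mem {a b g : Zd d} (hg : g ∈ box a b) : boxRep a b g = g := by
  funext j
  have := hg j
  simp only [boxRep]
  rw [Int.emod_eq_of_lt (by omega) (by omega)]
  omega

theorem boxRep_boxRep_add (a b g m : Zd d) :
    boxRep a b (boxRep a b g + m) = boxRep a b (g + m) := by
  funext j
  have h := congMod_boxRep a b g j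
  refine congrArg (a j + ·) (Int.modEq_iff_dvd.2 ?_)
  simpa only [Pi.add_apply, sub_sub_sub_cancel_right, add_sub_add_right_eq_sub] using h

theorem box_finite (a b : Zd d) : (box a b).Finite := by
  have h : box a b = Set.Icc a b := by
    ext g
    simp [box, Pi.le_def, forall_and]
  rw [h]
  exact Set.finite_Icc a b

/-- If an ANUCA with bounded singularity is uniformly injective, then every pattern on a finite
set is attained by its image. -/
theorem BoundedSingularity.exists_eqOn [Finite A] {M : Set (Zd d)}
    {s : Zd d → ((M → A) → A)} (hsing : BoundedSingularity M s) {N : Finset (Zd d)}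
    (hN : ∀ (g : Zd d) (x y : Zd d → A),
      (∀ n ∈ N, anucaZ M s x (g + n) = anucaZ M s y (g + n)) → x g = y g)
    {F : Set (Zd d)} (hF : F.Finite) (z : Zd d → A) :
    ∃ x, Set.EqOn (anucaZ M s x) z F := by
  obtain ⟨a, b, hab, hE, hs⟩ := hsing (F ∪ N) (hF.union N.finite_toSet)
  have hfin : Finite (box a b) := box_finite a b
  let r : Zd d → box a b := fun g => ⟨boxRep a b g, boxRep_mem hab g⟩
  let Φ : (box a b → A) → (box a b → A) := fun u k => s k fun m => u (r (k + m))
  have hΦ : ∀ (u : box a b → A) (g : Zd d), s g = s (r g) →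
      anucaZ M s (u ∘ r) g = Φ u (r g) := by
    intro u g hg
    have hr : ∀ m : M, r (g + m) = r (r g + m) := fun m =>
      Subtype.ext (boxRep_boxRep_add a b g m).symm
    simp only [anucaZ, Φ, Function.comp_apply, hg, hr]
  have hrk : ∀ k : box a b, r k = k := fun k => Subtype.ext (boxRep_of_mem k.2)
  have hΦinj : Function.Injective Φ := by
    intro u v huv
    funext k
    have h := hN k (u ∘ r) (v ∘ r) fun n hn => by
      have hsn : s (k + n) = s (r (k + n)) := by
        by_cases hk : (k + n : Zd d) ∈ box a b
        · exact congrArg s (boxRep_of_mem hk).symm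
        · exact hs _ ⟨Set.add_mem_add k.2 (Or.inr hn), hk⟩ _ (r _).2 (congMod_boxRep a b _)
      rw [hΦ u _ hsn, hΦ v _ hsn, huv]
    simpa [hrk] using h
  obtain ⟨u, hu⟩ := Finite.surjective_of_injective hΦinj fun k => z k
  refine ⟨u ∘ r, fun g hg => ?_⟩
  have hgr : boxRep a b g = g := boxRep_of_mem (hE (Or.inl hg))
  rw [hΦ u g (congrArg s hgr.symm), hu]
  exact congrArg z hgr

/-- Uniform injectivity yields a left inverse ANUCA with finite memory. -/
theorem exists_leftInverse_anucaZ {M : Set (Zd d)} {s : Zd d → ((M → A) → A)}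
    {N : Finset (Zd d)}
    (hN : ∀ (g : Zd d) (x y : Zd d → A),
      (∀ n ∈ N, anucaZ M s x (g + n) = anucaZ M s y (g + n)) → x g = y g) :
    ∃ N' : Set (Zd d), N'.Finite ∧ ∃ w : Zd d → ((N' → A) → A),
      Function.LeftInverse (anucaZ N' w) (anucaZ M s) := by
  classical
  refine ⟨insert 0 N, N.finite_toSet.insert 0, fun g c =>
    if h : ∃ x, ∀ n : (insert 0 N : Set (Zd d)), anucaZ M s x (g + n) = c n
    then h.choose g else c ⟨0, Set.mem_insert _ _⟩, fun x => funext fun g => ?_⟩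
  have h : ∃ x', ∀ n : (insert 0 N : Set (Zd d)),
      anucaZ M s x' (g + n) = anucaZ M s x (g + n) := ⟨x, fun _ => rfl⟩
  refine (dif_pos h).trans ?_
  exact hN g _ _ fun n hn => h.choose_spec ⟨n, Set.mem_insert_of_mem _ hn⟩

/-- Theorem C: a stably injective ANUCA over `ℤ^d` with bounded singularity is invertible. -/
theorem stmt3 [Finite A] (hd : 1 ≤ d) (M : Set (Zd d)) (hM : M.Finite)
    (s : Zd d → ((M → A) → A))
    (hinj : StablyInjectiveZ M s) (hsing : BoundedSingularity M s) :
    InvertibleANUCAZ M s := by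
  obtain ⟨N, hN⟩ := hinj.exists_window hM
  obtain ⟨N', hN', w, hw⟩ := exists_leftInverse_anucaZ hN
  have hw' : Function.RightInverse (anucaZ N' w) (anucaZ M s) := by
    intro z
    funext g
    obtain ⟨x, hx⟩ := hsing.exists_eqOn hN
      (((Set.finite_singleton g).add (hM.add hN')).insert g) z
    rw [← hx (Set.mem_insert _ _)]
    refine congrArg (s g) (funext fun m => ?_)
    conv_rhs => rw [← hw x]
    refine congrArg (w _) (funext fun n => (hx ?_).symm)
    refine Set.mem_insert_of_mem _ ?_
    rw [add_assoc]
    exact Set.add_mem_add rfl (Set.add_mem_add m.2 n.2)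
  exact ⟨⟨hw.injective, hw'.surjective⟩, N', hN', w, hw.comp_eq_id, hw'.comp_eq_id⟩
end

section
/- Let G be a residually finite group, i.e., for every finite subset E ⊆ G there exist a finite group H and a surjective group homomorphism φ : G → H whose restriction to E is injective. Then for all finite subsets M, E ⊆ G, there exist a finite subset K ⊆ G, a finite group H, and a surjective group homomorphism φ : G → H such that: (a) E ∪ M ⊆ K; (b) the restriction φ|_K : K → H is bijective; (c) φ(KM \ K) ∩ φ(E) = ∅. -/
open Pointwise

/-- For a residually finite group `G` and finite subsets `M, E ⊆ G`, there are a finite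
`K ⊆ G`, a finite group `H` and a surjective homomorphism `φ : G → H` such that
`E ∪ M ⊆ K`, `φ|_K : K → H` is bijective, and `φ(KM \ K) ∩ φ(E) = ∅`. -/
theorem stmt4 {G : Type*} [Group G]
    (hres : ∀ E : Set G, E.Finite →
      ∃ (H : Type) (_ : Group H) (_ : Finite H) (φ : G →* H),
        Function.Surjective φ ∧ Set.InjOn φ E)
    (M E : Set G) (hM : M.Finite) (hE : E.Finite) :
    ∃ K : Set G, K.Finite ∧
      ∃ (H : Type) (_ : Group H) (_ : Finite H) (φ : G →* H),
        Function.Surjective φ ∧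
        E ∪ M ⊆ K ∧
        Set.BijOn φ K Set.univ ∧
        (φ '' ((K * M) \ K)) ∩ (φ '' E) = ∅ := by
  obtain ⟨H, _, _, φ, hφ, hinj⟩ := hres (E ∪ M ∪ E * M⁻¹) ((hE.union hM).union (hE.mul hM.inv))
  obtain ⟨K, hFK, hK⟩ := hinj.bijOn_image.exists_extend (Set.subset_univ _)
    hφ.range_eq.superset
  refine ⟨K, Set.Finite.of_finite_image (Set.toFinite _) hK.injOn, H, _, ‹_›, φ, hφ,
    Set.subset_union_left.trans hFK, hK, ?_⟩
  rw [Set.eq_empty_iff_forall_notMem]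
  rintro _ ⟨⟨_, ⟨⟨k, hk, m, hm, rfl⟩, hkm⟩, rfl⟩, e, he, h⟩
  have hem : e * m⁻¹ ∈ K := hFK (.inr (Set.mul_mem_mul he (Set.inv_mem_inv.mpr hm)))
  have hk_eq : k = e * m⁻¹ := hK.injOn hk hem (by simp [h])
  apply hkm
  simpa [hk_eq] using hFK (.inl (.inl he))
end

section
/- Let G be a group, M, K ⊆ G finite subsets, A a finite set, S = A^(A^M), and s, t ∈ S^G. Let H be a finite group and φ : G → H a surjective group homomorphism such that φ|_K : K → H is a bijection. For x ∈ A^K define x̃ ∈ A^G by x̃(g) = x(k_g), where k_g ∈ K is the unique element with φ(g) = φ(k_g), and define Ψ_{K,s}, Ψ_{K,t} : A^K → A^K by Ψ_{K,s}(x) = (σ_s(x̃))|_K and Ψ_{K,t}(x) = (σ_t(x̃))|_K. If σ_t ∘ σ_s = Id and s(g) = s(k_g) for all g ∈ KM \ K, then Ψ_{K,t} ∘ Ψ_{K,s} = Id. -/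
open Pointwise

/-- If `σ_t ∘ σ_s = Id` and `s(g) = s(k_g)` for all `g ∈ KM \ K`, where `K` is a set of
representatives (via a surjective homomorphism `φ : G → H` onto a finite group restricting to
a bijection on `K`, with `k_g ∈ K` the unique element with `φ(k_g) = φ(g)`), then the induced
maps satisfy `Ψ_{K,t} ∘ Ψ_{K,s} = Id` on `A^K`, where `Ψ_{K,s}(x) = σ_s(x̃)|_K` and
`x̃(g) = x(k_g)`. -/
theorem stmt5 {G A : Type*} [Group G] [Finite A]
    (M K : Set G) (hM : M.Finite) (hK : K.Finite)
    (s t : G → ((M → A) → A))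
    (H : Type*) [Group H] [Finite H] (φ : G →* H)
    (hsurj : Function.Surjective φ) (hbij : Set.BijOn φ K Set.univ)
    (r : G → G) (hrK : ∀ g : G, r g ∈ K) (hrφ : ∀ g : G, φ (r g) = φ g)
    (hinv : anuca M t ∘ anuca M s = id)
    (hs : ∀ g ∈ (K * M) \ K, s g = s (r g)) :
    (fun x : K → A => fun k : K => anuca M t (fun g => x ⟨r g, hrK g⟩) (k : G)) ∘
      (fun x : K → A => fun k : K => anuca M s (fun g => x ⟨r g, hrK g⟩) (k : G)) = id := by
  have r_eq : ∀ a b : G, φ a = φ b → r a = r b := fun a b h =>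
    hbij.injOn (hrK a) (hrK b) (by rw [hrφ, hrφ, h])
  have r_fix : ∀ k ∈ K, r k = k := fun k hk => hbij.injOn (hrK k) hk (hrφ k)
  have s_eq : ∀ g ∈ K * M, s (r g) = s g := fun g hg => by
    by_cases hgK : g ∈ K
    · rw [r_fix g hgK]
    · exact (hs g ⟨hg, hgK⟩).symm
  funext x k
  have periodic : ∀ g ∈ K * M, anuca M s (fun g => x ⟨r g, hrK g⟩) (r g) =
      anuca M s (fun g => x ⟨r g, hrK g⟩) g := fun g hg => by
    simp only [anuca, s_eq g hg]
    congr 1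
    funext m
    congr 2
    exact r_eq _ _ (by rw [map_mul, map_mul, hrφ])
  calc anuca M t (fun g => anuca M s (fun g => x ⟨r g, hrK g⟩) (r g)) k
      = anuca M t (anuca M s (fun g => x ⟨r g, hrK g⟩)) k :=
        congrArg (t k) (funext fun m => periodic _ (Set.mul_mem_mul k.2 m.2))
    _ = x ⟨r k, hrK k⟩ := congrFun (congrFun hinv fun g => x ⟨r g, hrK g⟩) k
    _ = x k := congrArg x (Subtype.ext (r_fix k k.2))
end

section
/- Let G be a group, M ⊆ G a finite subset, A a set, and S = A^(A^M). Suppose that a sequence (x_n) in A^G converges to x ∈ A^G and a sequence (s_n) in S^G converges to s ∈ S^G, both with respect to the prodiscrete topology. Then the sequence (σ_{s_n}(x_n)) converges to σ_s(x) in A^G. -/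
open Pointwise

/-- Convergence in the prodiscrete topology means eventual equality in every coordinate. -/
theorem tendsto_prodiscrete_iff {ι G S : Type*} {l : Filter ι} {u : ι → G → S} {x : G → S} :
    Filter.Tendsto u l (@nhds _ (prodiscrete G S) x) ↔ ∀ g, ∀ᶠ i in l, u i g = x g := by
  let : TopologicalSpace S := ⊥
  have : DiscreteTopology S := ⟨rfl⟩
  change Filter.Tendsto u l (nhds x) ↔ _
  simp only [tendsto_pi_nhds, nhds_discrete, Filter.tendsto_pure]

/-- If `x_n → x` in `A^G` and `s_n → s` in `S^G` (prodiscrete topologies) and `M` is finite,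
then `σ_{s_n}(x_n) → σ_s(x)`. -/
theorem stmt7 {G A : Type*} [Group G] (M : Set G) (hM : M.Finite)
    (x : G → A) (s : G → ((M → A) → A))
    (xn : ℕ → (G → A)) (sn : ℕ → (G → ((M → A) → A)))
    (hx : Filter.Tendsto xn Filter.atTop (@nhds _ (prodiscrete G A) x))
    (hs : Filter.Tendsto sn Filter.atTop (@nhds _ (prodiscrete G ((M → A) → A)) s)) :
    Filter.Tendsto (fun n => anuca M (sn n) (xn n)) Filter.atTop
      (@nhds _ (prodiscrete G A) (anuca M s x)) := by
  rw [tendsto_prodiscrete_iff] at hx hs ⊢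
  intro g
  have : Finite M := hM
  have hxM : ∀ᶠ n in Filter.atTop, ∀ m : M, xn n (g * m) = x (g * m) :=
    Filter.eventually_all.2 fun m => hx (g * m)
  filter_upwards [hs g, hxM] with n hsn hxn
  simp only [anuca, hsn, hxn]
end

section
/- Let G be a countable group, M ⊆ G a finite subset, A a finite set, and S = A^(A^M). If s ∈ S^G and the ANUCA σ_s is post-surjective, then σ_s is surjective. -/
open Pointwise

/-- An ANUCA with finite memory is continuous for the prodiscrete topology. -/
theorem continuous_anuca_s10 {G A : Type*} [Group G] [TopologicalSpace A] [DiscreteTopology A]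
    {M : Set G} (hM : M.Finite) (s : G → ((M → A) → A)) : Continuous (anuca M s) := by
  have : Finite M := hM
  refine continuous_pi fun g => ?_
  exact (continuous_of_discreteTopology (f := s g)).comp
    (continuous_pi fun m => continuous_apply (g * (m : G)))

open Filter Topology in
/-- The configurations agreeing with `y` on a finite set and with `z` elsewhere converge to `y`. -/
theorem tendsto_finset_piecewise {G A : Type*} [DecidableEq G] [TopologicalSpace A]
    (y z : G → A) :
    Tendsto (fun F : Finset G => F.piecewise y z) atTop (𝓝 y) := by
  refine tendsto_pi_nhds.2 fun g => tendsto_nhds_of_eventually_eq ?_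
  filter_upwards [eventually_ge_atTop {g}] with F hF
  exact Finset.piecewise_eq_of_mem F y z (hF (Finset.mem_singleton_self g))

/-- Over a countable group and finite alphabet, every post-surjective ANUCA with
finite memory is surjective. -/
theorem stmt10 {G A : Type*} [Group G] [Countable G] [Finite A]
    (M : Set G) (hM : M.Finite) (s : G → ((M → A) → A))
    (h : PostSurjective (anuca M s)) :
    Function.Surjective (anuca M s) := by
  classical
  intro y
  let _ : TopologicalSpace A := ⊥
  have : DiscreteTopology A := ⟨rfl⟩
  have hclosed : IsClosed (Set.range (anuca M s)) :=
    (isCompact_range (continuous_anuca_s10 hM s)).isClosed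
  refine hclosed.mem_of_tendsto (tendsto_finset_piecewise y (anuca M s y))
    (Filter.Eventually.of_forall fun F => ?_)
  have hasymp : Asymptotic (F.piecewise y (anuca M s y)) (anuca M s y) := by
    refine F.finite_toSet.subset fun g hg => ?_
    by_contra hgF
    exact hg (Finset.piecewise_eq_of_notMem F _ _ hgF)
  obtain ⟨z, -, hz⟩ := h y _ hasymp
  exact ⟨z, hz⟩
end

section
/- Let G be a group, let M, N ⊆ G be subsets, A a set, and let s ∈ S^G, t ∈ T^G where S = A^(A^M) and T = A^(A^N). Then there exists q ∈ Q^G, where Q = A^(A^(MN)) and MN = {mn : m ∈ M, n ∈ N}, such that σ_s ∘ σ_t = σ_q. In particular, the composition of two ANUCA over the same universe and alphabet is again an ANUCA. -/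
open Pointwise

/-- The composition of two ANUCA is an ANUCA: `σ_s ∘ σ_t = σ_q` for some configuration `q`
of local defining maps with memory `MN`. -/
theorem stmt13 {G A : Type*} [Group G] (M N : Set G)
    (s : G → ((M → A) → A)) (t : G → ((N → A) → A)) :
    ∃ q : G → (((M * N : Set G) → A) → A),
      anuca M s ∘ anuca N t = anuca (M * N : Set G) q := by
  refine ⟨fun g y => s g fun m => t (g * m) fun n =>
    y ⟨(m : G) * n, Set.mul_mem_mul m.2 n.2⟩, ?_⟩
  funext x g
  simp only [anuca, Function.comp_apply, mul_assoc]
end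

section
/- Let G be an infinite finitely generated group and let S be a finite set. Suppose s ∈ S^G is asymptotic to a constant configuration c ∈ S^G. Then Σ(s) = {g·s : g ∈ G} ∪ {c}, where Σ(s) is the closure of the shift orbit of s in S^G with the prodiscrete topology. -/
open Pointwise

theorem mem_orbitClosure_iff {G S : Type*} [Group G] (s p : G → S) :
    p ∈ orbitClosure s ↔ ∀ F : Finset G, ∃ g : G, ∀ h ∈ F, s (g⁻¹ * h) = p h := by
  let _ : TopologicalSpace S := ⊥
  have : DiscreteTopology S := ⟨rfl⟩
  change p ∈ closure {q | ∃ g : G, shiftC g s = q} ↔ _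
  rw [mem_closure_iff]
  constructor
  · intro hp F
    have hopen : IsOpen ((F : Set G).pi fun h => ({p h} : Set S)) :=
      isOpen_set_pi F.finite_toSet fun h _ => isOpen_discrete _
    obtain ⟨_, hq, g, rfl⟩ := hp _ hopen fun h _ => rfl
    exact ⟨g, fun h hh => hq h hh⟩
  · intro hp U hU hpU
    obtain ⟨F, u, hu, hsub⟩ := isOpen_pi_iff.1 hU p hpU
    obtain ⟨g, hg⟩ := hp F
    refine ⟨shiftC g s, hsub fun h hh => ?_, g, rfl⟩
    change s (g⁻¹ * h) ∈ u h
    rw [hg h hh]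
    exact (hu h hh).2

theorem finite_setOf_inv_mul_mem {G : Type*} [Group G] {D : Set G} (hD : D.Finite) (h : G) :
    {g : G | g⁻¹ * h ∈ D}.Finite :=
  hD.preimage fun _ _ _ _ hab => inv_injective (mul_right_cancel hab)

/-- For an infinite finitely generated group `G` and a configuration `s ∈ S^G` asymptotic
to the constant configuration `c`, one has `Σ(s) = {g·s : g ∈ G} ∪ {c}`. -/
theorem stmt16 {G S : Type*} [Group G] [Infinite G] [Finite S]
    (hfg : ∃ T : Finset G, Subgroup.closure (T : Set G) = ⊤)
    (s c : G → S) (hconst : ∀ g h : G, c g = c h) (hasym : Asymptotic s c) :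
    orbitClosure s = {p : G → S | ∃ g : G, shiftC g s = p} ∪ {c} := by
  ext p
  rw [mem_orbitClosure_iff]
  constructor
  · intro hp
    by_cases hpc : p = c
    · exact Or.inr hpc
    obtain ⟨k, hk⟩ := Function.ne_iff.1 hpc
    left
    by_contra hno
    have hne : ∀ g : G, ∃ h, s (g⁻¹ * h) ≠ p h := fun g =>
      Function.ne_iff.1 fun he => hno ⟨g, he⟩
    choose w hw using hne
    have hfin := ((finite_setOf_inv_mul_mem hasym k).image w).insert k
    obtain ⟨g, hg⟩ := hp hfin.toFinset
    have hgk : s (g⁻¹ * k) = p k := hg k (by simp)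
    have hmem : g⁻¹ * k ∈ {h : G | s h ≠ c h} := by
      change s (g⁻¹ * k) ≠ c (g⁻¹ * k)
      rwa [hgk, hconst (g⁻¹ * k) k]
    exact hw g (hg _ (hfin.mem_toFinset.2 (Or.inr ⟨g, hmem, rfl⟩)))
  · rintro (⟨g, rfl⟩ | rfl) F
    · exact ⟨g, fun _ _ => rfl⟩
    · obtain ⟨g, hg⟩ := (F.finite_toSet.biUnion fun h _ =>
        finite_setOf_inv_mul_mem hasym h).exists_notMem
      refine ⟨g, fun h hh => ?_⟩
      by_contra hcon
      refine hg (Set.mem_biUnion hh ?_)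
      change s (g⁻¹ * h) ≠ p (g⁻¹ * h)
      rwa [hconst (g⁻¹ * h) h]
end

section
/- Let G be a countable group, M ⊆ G a finite subset, A a finite set, and S = A^(A^M). Suppose σ_s is post-surjective for some s ∈ S^G. Then for each g ∈ G there exists a finite subset E ⊆ G such that for all x, y ∈ A^G with y agreeing with σ_s(x) on G \ {g}, there exists z ∈ A^G such that σ_s(z) = y and z agrees with x on G \ gE, where gE = {gh : h ∈ E}. -/
open Pointwise

/-- Local form of uniform post-surjectivity at `g`: near a given `x`, the value `a` prescribed
at `g` can be reached by modifying configurations inside one finite set. -/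
lemma PostSurjective.exists_finite_local {G A : Type*} [Group G]
    {M : Set G} (hM : M.Finite) {s : G → ((M → A) → A)}
    (hps : PostSurjective (anuca M s)) (g : G) (a : A) (x : G → A) :
    ∃ K F : Set G, K.Finite ∧ F.Finite ∧ ∀ x' : G → A, (∀ h ∈ K, x' h = x h) →
      ∀ y : G → A, y g = a → (∀ h : G, h ≠ g → y h = anuca M s x' h) →
      ∃ z : G → A, anuca M s z = y ∧ ∀ h : G, h ∉ F → z h = x' h := by
  classical
  obtain ⟨z, hzx, hz⟩ := hps x (Function.update (anuca M s x) g a)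
    ((Set.finite_singleton g).subset fun h hh => by
      by_contra hne
      exact hh (Function.update_of_ne hne _ _))
  set F : Set G := {h | z h ≠ x h} with hF
  have hFfin : F.Finite := hzx
  refine ⟨F * M⁻¹ * M ∪ {g} * M, F, ((hFfin.mul hM.inv).mul hM).union
    ((Set.finite_singleton g).mul hM), hFfin, fun x' hx' y hyg hy => ?_⟩
  refine ⟨fun h => if h ∈ F then z h else x' h, ?_, fun h hh => if_neg hh⟩
  have near : ∀ h : G, (∀ m : M, x' (h * m) = x (h * m)) →
      anuca M s (fun h => if h ∈ F then z h else x' h) h = y h := by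
    intro h hh
    have hz' : anuca M s (fun h => if h ∈ F then z h else x' h) h = anuca M s z h := by
      refine congrArg (s h) (funext fun m => ?_)
      by_cases hm : h * (m : G) ∈ F
      · exact if_pos hm
      · exact (if_neg hm).trans ((hh m).trans (not_not.mp hm).symm)
    rw [hz', hz]
    by_cases hg : h = g
    · subst hg
      simp [hyg]
    · rw [Function.update_of_ne hg, hy h hg]
      exact congrArg (s h) (funext fun m => (hh m).symm)
  funext h
  by_cases hg : h = g
  · subst hg
    exact near h fun m => hx' _ (Or.inr (Set.mul_mem_mul rfl m.2))
  by_cases hm : ∃ m : M, h * (m : G) ∈ F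
  · obtain ⟨m, hm⟩ := hm
    refine near h fun m' => hx' _ (Or.inl (Set.mul_mem_mul ?_ m'.2))
    simpa using Set.mul_mem_mul hm (Set.inv_mem_inv.mpr m.2)
  · push Not at hm
    rw [hy h hg]
    exact congrArg (s h) (funext fun m => if_neg (hm m))

/-- Configurations over a finite alphabet: a property of finite sets that is monotone and locally
witnessed is witnessed uniformly. -/
lemma exists_finite_uniform_of_local {G A : Type*} [Finite A] {P : Set G → (G → A) → Prop}
    (mono : ∀ F F' x, F ⊆ F' → P F x → P F' x)
    (loc : ∀ x : G → A, ∃ K F : Set G, K.Finite ∧ F.Finite ∧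
      ∀ x' : G → A, (∀ h ∈ K, x' h = x h) → P F x') :
    ∃ F : Set G, F.Finite ∧ ∀ x, P F x := by
  let _ : TopologicalSpace A := ⊥
  have : DiscreteTopology A := ⟨rfl⟩
  choose K F hK hF hP using loc
  obtain ⟨t, -, ht⟩ := (isCompact_univ (X := G → A)).elim_nhds_subcover
    (fun x => (K x).pi fun h => {x h}) fun x _ =>
      set_pi_mem_nhds (hK x) fun h _ => (isOpen_discrete _).mem_nhds rfl
  refine ⟨⋃ x ∈ t, F x, t.finite_toSet.biUnion fun x _ => hF x, fun x' => ?_⟩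
  obtain ⟨x, hx, hx'⟩ := Set.mem_iUnion₂.mp (ht (Set.mem_univ x'))
  exact mono _ _ _ (Set.subset_biUnion_of_mem (u := F) hx) (hP x x' hx')

/-- Pointwise uniform post-surjectivity: if `σ_s` is post-surjective, then for each `g ∈ G`
there is a finite `E ⊆ G` such that whenever `y` agrees with `σ_s(x)` off `{g}`, some `z`
agreeing with `x` off `gE` satisfies `σ_s(z) = y`. -/
theorem stmt18 {G A : Type*} [Group G] [Countable G] [Finite A]
    (M : Set G) (hM : M.Finite) (s : G → ((M → A) → A))
    (hps : PostSurjective (anuca M s)) (g : G) :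
    ∃ E : Set G, E.Finite ∧ ∀ x y : G → A,
      (∀ h : G, h ≠ g → y h = anuca M s x h) →
      ∃ z : G → A, anuca M s z = y ∧ ∀ h : G, h ∉ g • E → z h = x h := by
  have key : ∀ a : A, ∃ F : Set G, F.Finite ∧ ∀ x : G → A, ∀ y : G → A, y g = a →
      (∀ h : G, h ≠ g → y h = anuca M s x h) →
      ∃ z : G → A, anuca M s z = y ∧ ∀ h : G, h ∉ F → z h = x h := fun a =>
    exists_finite_uniform_of_local
      (fun F F' x hFF' hx y hyg hy => (hx y hyg hy).imp fun z hz =>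
        ⟨hz.1, fun h hh => hz.2 h fun hF => hh (hFF' hF)⟩)
      (hps.exists_finite_local hM g a)
  choose F hF hz using key
  refine ⟨g⁻¹ • ⋃ a, F a, (Set.finite_iUnion hF).smul_set, fun x y hy => ?_⟩
  obtain ⟨z, hzy, hzx⟩ := hz (y g) x y rfl hy
  refine ⟨z, hzy, fun h hh => hzx h fun hF => hh ?_⟩
  rw [smul_inv_smul]
  exact Set.mem_iUnion_of_mem _ hF
end
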